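/- If w ∈ A_p(ℝ) for some p ∈ (1,∞), then there exists ε > 0 with p − ε > 1 such that w ∈ A_{p−ε}(ℝ). Moreover, the choice of ε and the bound on [w]_{A_{p−ε}} depend only on p and [w]_{A_p}: if 𝒱 ⊂ A_p(ℝ) satisfies sup_{w∈𝒱} [w]_{A_p} < ∞, then there exists ε > 0 with 𝒱 ⊂ A_{p−ε}(ℝ) and sup_{w∈𝒱} [w]_{A_{p−ε}} < ∞. -/

import Mathlib

open MeasureTheory

/-- The average of `w` over the interval `[a,b]`. -/
noncomputable def intervalAvg (w : ℝ → ℝ) (a b : ℝ) : ℝ := (∫ x in a..b, w x) / (b - a)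

/-- `w` satisfies the Muckenhoupt `A_p` condition on `ℝ` with constant (at most) `C`. -/
def ApWith (p : ℝ) (w : ℝ → ℝ) (C : ℝ) : Prop :=
  ∀ a b : ℝ, a < b →
    intervalAvg w a b * (intervalAvg (fun x => w x ^ (-1 / (p - 1))) a b) ^ (p - 1) ≤ C

/-- A Bellman function for the reverse Hölder inequality, evaluated at the averages `x` of the
weight and `y` of its dual weight. -/
noncomputable def bellman (s δ x y : ℝ) : ℝ := 2 * y ^ (1 + δ) - x ^ (-s) * y⁻¹

theorem rpow_one_add_add_rpow_one_sub_le {δ η : ℝ} (hδ : 0 ≤ δ) (hδ' : δ ≤ 1)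
    (h₁ : -1 < η) (h₂ : η < 1) :
    (1 + η) ^ (1 + δ) + (1 - η) ^ (1 + δ) ≤ 2 + 2 * δ * η ^ 2 := by
  have key : ∀ t : ℝ, -1 < t → (1 + t) ^ (1 + δ) ≤ (1 + t) * (1 + δ * t) := fun t ht => by
    rw [Real.rpow_add (by linarith), Real.rpow_one]
    exact mul_le_mul_of_nonneg_left (rpow_one_add_le_one_add_mul_self ht.le hδ hδ') (by linarith)
  have h := key η h₁
  have h' := key (-η) (by linarith)
  rw [← sub_eq_add_neg] at h'
  linarith

theorem two_add_sq_le_rpow_neg_mul_inv {s ξ η : ℝ} (hs : 0 ≤ s) (hξ₁ : -1 < ξ) (hξ₂ : ξ < 1)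
    (hη₁ : -1 < η) (hη₂ : η < 1) :
    2 + η ^ 2 ≤ (1 + ξ) ^ (-s) * (1 + η)⁻¹ + (1 - ξ) ^ (-s) * (1 - η)⁻¹ := by
  have hA : 0 < (1 + ξ) ^ (-s) := Real.rpow_pos_of_pos (by linarith) _
  have hA' : 0 < (1 - ξ) ^ (-s) := Real.rpow_pos_of_pos (by linarith) _
  have hAA : 1 ≤ (1 + ξ) ^ (-s) * (1 - ξ) ^ (-s) := by
    rw [← Real.mul_rpow (by linarith) (by linarith)]
    exact Real.one_le_rpow_of_pos_of_le_one_of_nonpos (mul_pos (by linarith) (by linarith))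
      (by nlinarith [sq_nonneg ξ]) (by linarith)
  generalize (1 + ξ) ^ (-s) = A at *
  generalize (1 - ξ) ^ (-s) = A' at *
  have h₁ : 0 < 1 + η := by linarith
  have h₂ : 0 < 1 - η := by linarith
  have ht : 0 ≤ 1 - η ^ 2 := by nlinarith
  have hmul : (2 + η ^ 2) * (1 - η ^ 2) ≤ A * (1 - η) + A' * (1 + η) := by
    refine le_of_sq_le_sq ?_ (by positivity)
    have h₃ : 4 * (1 - η ^ 2) ≤ 4 * (A * A') * (1 - η ^ 2) :=
      mul_le_mul_of_nonneg_right (by linarith) ht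
    have h₄ : (2 + η ^ 2) ^ 2 * (1 - η ^ 2) ≤ 4 := by
      nlinarith [sq_nonneg η, sq_nonneg (η ^ 2), mul_nonneg (sq_nonneg η) (sq_nonneg (η ^ 2))]
    have h₅ := mul_le_mul_of_nonneg_right h₄ ht
    nlinarith [sq_nonneg (A * (1 - η) - A' * (1 + η))]
  have : A * (1 + η)⁻¹ + A' * (1 - η)⁻¹ = (A * (1 - η) + A' * (1 + η)) / (1 - η ^ 2) := by
    have : 1 - η ^ 2 ≠ 0 := by
      rw [show 1 - η ^ 2 = (1 + η) * (1 - η) by ring]; positivity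
    field_simp
    ring
  rw [this, le_div_iff₀ (by nlinarith)]
  exact hmul

theorem bellman_midpoint_le {s δ x₁ x₂ y₁ y₂ : ℝ} (hs : 0 ≤ s) (hδ : 0 ≤ δ) (hδ' : δ ≤ 1)
    (hx₁ : 0 < x₁) (hx₂ : 0 < x₂) (hy₁ : 0 < y₁) (hy₂ : 0 < y₂)
    (h : 4 * δ * ((y₁ + y₂) / 2) ^ (1 + δ) ≤ ((x₁ + x₂) / 2) ^ (-s) * ((y₁ + y₂) / 2)⁻¹) :
    bellman s δ x₁ y₁ + bellman s δ x₂ y₂ ≤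
      2 * bellman s δ ((x₁ + x₂) / 2) ((y₁ + y₂) / 2) := by
  obtain ⟨x, hx⟩ : ∃ x, x = (x₁ + x₂) / 2 := ⟨_, rfl⟩
  obtain ⟨y, hy⟩ : ∃ y, y = (y₁ + y₂) / 2 := ⟨_, rfl⟩
  obtain ⟨ξ, hξ⟩ : ∃ ξ, ξ = (x₁ - x₂) / (x₁ + x₂) := ⟨_, rfl⟩
  obtain ⟨η, hη⟩ : ∃ η, η = (y₁ - y₂) / (y₁ + y₂) := ⟨_, rfl⟩
  have ex₁ : x₁ = x * (1 + ξ) := by subst hx hξ; field_simp; ring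
  have ex₂ : x₂ = x * (1 - ξ) := by subst hx hξ; field_simp; ring
  have ey₁ : y₁ = y * (1 + η) := by subst hy hη; field_simp; ring
  have ey₂ : y₂ = y * (1 - η) := by subst hy hη; field_simp; ring
  have hx0 : 0 < x := by rw [hx]; positivity
  have hy0 : 0 < y := by rw [hy]; positivity
  rw [← hx, ← hy] at h ⊢
  rw [ex₁] at hx₁
  rw [ex₂] at hx₂
  rw [ey₁] at hy₁
  rw [ey₂] at hy₂
  have px₁ := pos_of_mul_pos_right hx₁ hx0.le
  have px₂ := pos_of_mul_pos_right hx₂ hx0.le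
  have py₁ := pos_of_mul_pos_right hy₁ hy0.le
  have py₂ := pos_of_mul_pos_right hy₂ hy0.le
  have H₁ := mul_le_mul_of_nonneg_left (rpow_one_add_add_rpow_one_sub_le hδ hδ'
    (η := η) (by linarith) (by linarith)) (Real.rpow_nonneg hy0.le (1 + δ))
  have H₂ := mul_le_mul_of_nonneg_left (two_add_sq_le_rpow_neg_mul_inv hs
    (ξ := ξ) (η := η) (by linarith) (by linarith) (by linarith) (by linarith))
    (mul_nonneg (Real.rpow_nonneg hx0.le (-s)) (inv_nonneg.2 hy0.le))
  have H₃ := mul_le_mul_of_nonneg_right h (sq_nonneg η)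
  unfold bellman
  rw [ex₁, ex₂, ey₁, ey₂, Real.mul_rpow hx0.le px₁.le, Real.mul_rpow hx0.le px₂.le,
    Real.mul_rpow hy0.le py₁.le, Real.mul_rpow hy0.le py₂.le, mul_inv, mul_inv]
  linarith

theorem rpow_neg_mul_inv_eq {q δ x y : ℝ} (hq : 0 < q) (hx : 0 < x) (hy : 0 < y) :
    x ^ (-((2 + δ) / q)) * y⁻¹ = (x * y ^ q) ^ (-((2 + δ) / q)) * y ^ (1 + δ) := by
  rw [Real.mul_rpow hx.le (Real.rpow_nonneg hy.le _), ← Real.rpow_mul hy.le, mul_assoc,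
    ← Real.rpow_add hy, ← Real.rpow_neg_one]
  congr 2
  field_simp
  ring

theorem intervalAvg_midpoint {f : ℝ → ℝ} {a b : ℝ} (hab : a < b)
    (hf : IntegrableOn f (Set.Ioc a b)) :
    intervalAvg f a b = (intervalAvg f a ((a + b) / 2) + intervalAvg f ((a + b) / 2) b) / 2 := by
  have h₁ : IntervalIntegrable f volume a ((a + b) / 2) :=
    (intervalIntegrable_iff_integrableOn_Ioc_of_le (by linarith)).2
      (hf.mono_set (Set.Ioc_subset_Ioc_right (by linarith)))
  have h₂ : IntervalIntegrable f volume ((a + b) / 2) b :=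
    (intervalIntegrable_iff_integrableOn_Ioc_of_le (by linarith)).2
      (hf.mono_set (Set.Ioc_subset_Ioc_left (by linarith)))
  unfold intervalAvg
  rw [← intervalIntegral.integral_add_adjacent_intervals h₁ h₂,
    show (a + b) / 2 - a = (b - a) / 2 by ring, show b - (a + b) / 2 = (b - a) / 2 by ring]
  have : b - a ≠ 0 := by linarith
  field_simp

theorem intervalAvg_pos {f : ℝ → ℝ} {a b : ℝ} (hab : a < b) (hf : IntegrableOn f (Set.Ioc a b))
    (hpos : ∀ x, 0 < f x) : 0 < intervalAvg f a b :=
  div_pos (intervalIntegral.intervalIntegral_pos_of_pos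
    ((intervalIntegrable_iff_integrableOn_Ioc_of_le hab.le).2 hf) hpos hab) (by linarith)

/-- The average of `f` over the interval of the `n`-th dyadic partition of `(a, b]` that
contains `x`. -/
noncomputable def dyadicAvg (f : ℝ → ℝ) : ℕ → ℝ → ℝ → ℝ → ℝ
  | 0, a, b, _ => intervalAvg f a b
  | n + 1, a, b, x =>
    if x ≤ (a + b) / 2 then dyadicAvg f n a ((a + b) / 2) x else dyadicAvg f n ((a + b) / 2) b x

theorem measurable_dyadicAvg (f : ℝ → ℝ) (n : ℕ) (a b : ℝ) : Measurable (dyadicAvg f n a b) := by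
  induction n generalizing a b with
  | zero => exact measurable_const
  | succ n ih => exact Measurable.ite measurableSet_Iic (ih _ _) (ih _ _)

theorem exists_dyadicAvg_eq_intervalAvg (f : ℝ → ℝ) (n : ℕ) {a b x : ℝ} (hx : x ∈ Set.Ioc a b) :
    ∃ l r, x ∈ Set.Ioc l r ∧ r - l = (b - a) / 2 ^ n ∧ a ≤ l ∧ r ≤ b ∧
      dyadicAvg f n a b x = intervalAvg f l r := by
  induction n generalizing a b with
  | zero => exact ⟨a, b, hx, by simp, le_rfl, le_rfl, rfl⟩
  | succ n ih =>
    have hx₁ := hx.1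
    have hx₂ := hx.2
    by_cases h : x ≤ (a + b) / 2
    · obtain ⟨l, r, hlr, hlen, hl, hr, he⟩ := ih (a := a) (b := (a + b) / 2) ⟨hx.1, h⟩
      refine ⟨l, r, hlr, ?_, hl, by linarith, ?_⟩
      · rw [hlen, pow_succ]; field_simp; ring
      · rw [dyadicAvg, if_pos h, he]
    · obtain ⟨l, r, hlr, hlen, hl, hr, he⟩ := ih (a := (a + b) / 2) (b := b) ⟨not_le.1 h, hx.2⟩
      refine ⟨l, r, hlr, ?_, by linarith, hr, ?_⟩
      · rw [hlen, pow_succ]; field_simp; ring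
      · rw [dyadicAvg, if_neg h, he]

theorem ae_tendsto_dyadicAvg {f : ℝ → ℝ} {a b : ℝ} (hf : IntegrableOn f (Set.Ioc a b)) :
    ∀ᵐ x ∂volume.restrict (Set.Ioc a b),
      Filter.Tendsto (fun n => dyadicAvg f n a b x) Filter.atTop (nhds (f x)) := by
  have hint : Integrable ((Set.Ioc a b).indicator f) :=
    (integrable_indicator_iff measurableSet_Ioc).2 hf
  rw [ae_restrict_iff' measurableSet_Ioc]
  filter_upwards [IsUnifLocDoublingMeasure.ae_tendsto_average (volume : Measure ℝ)
    hint.locallyIntegrable 1] with x hx hxab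
  choose l r hlr hlen hl hr he using fun n => exists_dyadicAvg_eq_intervalAvg f n hxab
  have hδ : Filter.Tendsto (fun n : ℕ => (r n - l n) / 2) Filter.atTop
      (nhdsWithin 0 (Set.Ioi 0)) := by
    refine tendsto_nhdsWithin_iff.2 ⟨?_, Filter.Eventually.of_forall fun n => ?_⟩
    · have := (tendsto_pow_atTop_nhds_zero_of_lt_one (r := (1 / 2 : ℝ)) (by norm_num)
        (by norm_num)).const_mul ((b - a) / 2)
      rw [mul_zero] at this
      refine this.congr fun n => ?_
      rw [hlen, one_div, inv_pow]
      ring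
    · have := (hlr n).1.trans_le (hlr n).2
      simp only [Set.mem_Ioi]
      linarith
  have hball : ∀ n, Metric.closedBall ((l n + r n) / 2) ((r n - l n) / 2) =
      Set.Icc (l n) (r n) := fun n => by
    rw [Real.closedBall_eq_Icc]
    congr 1 <;> ring
  have := hx (fun n => (l n + r n) / 2) (fun n => (r n - l n) / 2) hδ
    (Filter.Eventually.of_forall fun n => by
      rw [one_mul, hball]
      exact Set.Ioc_subset_Icc_self (hlr n))
  rw [Set.indicator_of_mem hxab] at this
  refine this.congr fun n => ?_
  have hlt : l n < r n := (hlr n).1.trans_le (hlr n).2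
  rw [he n, hball, setAverage_eq, integral_Icc_eq_integral_Ioc, intervalAvg,
    intervalIntegral.integral_of_le hlt.le, Real.volume_real_Icc_of_le hlt.le, smul_eq_mul,
    div_eq_inv_mul]
  congr 1
  exact setIntegral_congr_fun measurableSet_Ioc fun y hy =>
    Set.indicator_of_mem (Set.Ioc_subset_Ioc (hl n) (hr n) hy) f

theorem lintegral_dyadicAvg_rpow_le {w σ : ℝ → ℝ} {s δ : ℝ} (hs : 0 ≤ s) (hδ : 0 ≤ δ)
    (hδ' : δ ≤ 1) (n : ℕ) {a b : ℝ} (hab : a < b)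
    (hw : IntegrableOn w (Set.Ioc a b)) (hσ : IntegrableOn σ (Set.Ioc a b))
    (hw0 : ∀ x, 0 < w x) (hσ0 : ∀ x, 0 < σ x)
    (hlow : ∀ l r, a ≤ l → l < r → r ≤ b →
      intervalAvg σ l r ^ (1 + δ) ≤ bellman s δ (intervalAvg w l r) (intervalAvg σ l r))
    (hupp : ∀ l r, a ≤ l → l < r → r ≤ b → 4 * δ * intervalAvg σ l r ^ (1 + δ) ≤
      intervalAvg w l r ^ (-s) * (intervalAvg σ l r)⁻¹) :
    ∫⁻ x in Set.Ioc a b, ENNReal.ofReal (dyadicAvg σ n a b x ^ (1 + δ)) ≤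
      ENNReal.ofReal ((b - a) * bellman s δ (intervalAvg w a b) (intervalAvg σ a b)) := by
  induction n generalizing a b with
  | zero =>
    simp only [dyadicAvg, lintegral_const, Measure.restrict_apply MeasurableSet.univ,
      Set.univ_inter, Real.volume_Ioc]
    rw [← ENNReal.ofReal_mul' (by linarith), mul_comm]
    exact ENNReal.ofReal_le_ofReal
      (mul_le_mul_of_nonneg_left (hlow a b le_rfl hab le_rfl) (by linarith))
  | succ n ih =>
    obtain ⟨m, hm⟩ : ∃ m, m = (a + b) / 2 := ⟨_, rfl⟩
    have ham : a < m := by linarith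
    have hmb : m < b := by linarith
    have hl : Set.Ioc a m ⊆ Set.Ioc a b := Set.Ioc_subset_Ioc_right hmb.le
    have hr : Set.Ioc m b ⊆ Set.Ioc a b := Set.Ioc_subset_Ioc_left ham.le
    have I₁ := ih ham (hw.mono_set hl) (hσ.mono_set hl)
      (fun l r h₁ h₂ h₃ => hlow l r h₁ h₂ (h₃.trans hmb.le))
      (fun l r h₁ h₂ h₃ => hupp l r h₁ h₂ (h₃.trans hmb.le))
    have I₂ := ih hmb (hw.mono_set hr) (hσ.mono_set hr)
      (fun l r h₁ h₂ h₃ => hlow l r (ham.le.trans h₁) h₂ h₃)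
      (fun l r h₁ h₂ h₃ => hupp l r (ham.le.trans h₁) h₂ h₃)
    have E₁ : ∫⁻ x in Set.Ioc a m, ENNReal.ofReal (dyadicAvg σ (n + 1) a b x ^ (1 + δ)) =
        ∫⁻ x in Set.Ioc a m, ENNReal.ofReal (dyadicAvg σ n a m x ^ (1 + δ)) :=
      setLIntegral_congr_fun measurableSet_Ioc fun x hx => by
        simp only [dyadicAvg, ← hm, if_pos hx.2]
    have E₂ : ∫⁻ x in Set.Ioc m b, ENNReal.ofReal (dyadicAvg σ (n + 1) a b x ^ (1 + δ)) =
        ∫⁻ x in Set.Ioc m b, ENNReal.ofReal (dyadicAvg σ n m b x ^ (1 + δ)) :=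
      setLIntegral_congr_fun measurableSet_Ioc fun x hx => by
        simp only [dyadicAvg, ← hm, if_neg (not_le.2 hx.1)]
    have nonneg : ∀ l r, a ≤ l → l < r → r ≤ b →
        0 ≤ (r - l) * bellman s δ (intervalAvg w l r) (intervalAvg σ l r) :=
      fun l r h₁ h₂ h₃ => mul_nonneg (by linarith) ((Real.rpow_nonneg (intervalAvg_pos h₂
        (hσ.mono_set (Set.Ioc_subset_Ioc h₁ h₃)) hσ0).le _).trans (hlow l r h₁ h₂ h₃))
    rw [← Set.Ioc_union_Ioc_eq_Ioc ham.le hmb.le, lintegral_union measurableSet_Ioc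
      (Set.Ioc_disjoint_Ioc_of_le le_rfl), E₁, E₂]
    refine (add_le_add I₁ I₂).trans ?_
    rw [← ENNReal.ofReal_add (nonneg a m le_rfl ham hmb.le) (nonneg m b ham.le hmb le_rfl)]
    refine ENNReal.ofReal_le_ofReal ?_
    have hA := hupp a b le_rfl hab le_rfl
    rw [intervalAvg_midpoint hab hw, intervalAvg_midpoint hab hσ, ← hm] at hA ⊢
    have key := bellman_midpoint_le hs hδ hδ' (intervalAvg_pos ham (hw.mono_set hl) hw0)
      (intervalAvg_pos hmb (hw.mono_set hr) hw0) (intervalAvg_pos ham (hσ.mono_set hl) hσ0)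
      (intervalAvg_pos hmb (hσ.mono_set hr) hσ0) hA
    have e₁ : m - a = (b - a) / 2 := by rw [hm]; ring
    have e₂ : b - m = (b - a) / 2 := by rw [hm]; ring
    rw [e₁, e₂]
    have := mul_le_mul_of_nonneg_left key (show 0 ≤ (b - a) / 2 by linarith)
    linarith

theorem lintegral_rpow_le {w σ : ℝ → ℝ} {s δ : ℝ} (hs : 0 ≤ s) (hδ : 0 ≤ δ)
    (hδ' : δ ≤ 1) {a b : ℝ} (hab : a < b)
    (hw : IntegrableOn w (Set.Ioc a b)) (hσ : IntegrableOn σ (Set.Ioc a b))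
    (hw0 : ∀ x, 0 < w x) (hσ0 : ∀ x, 0 < σ x)
    (hlow : ∀ l r, a ≤ l → l < r → r ≤ b →
      intervalAvg σ l r ^ (1 + δ) ≤ bellman s δ (intervalAvg w l r) (intervalAvg σ l r))
    (hupp : ∀ l r, a ≤ l → l < r → r ≤ b → 4 * δ * intervalAvg σ l r ^ (1 + δ) ≤
      intervalAvg w l r ^ (-s) * (intervalAvg σ l r)⁻¹) :
    ∫⁻ x in Set.Ioc a b, ENNReal.ofReal (σ x ^ (1 + δ)) ≤
      ENNReal.ofReal ((b - a) * (2 * intervalAvg σ a b ^ (1 + δ))) := by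
  calc ∫⁻ x in Set.Ioc a b, ENNReal.ofReal (σ x ^ (1 + δ))
      = ∫⁻ x in Set.Ioc a b, Filter.liminf
          (fun n => ENNReal.ofReal (dyadicAvg σ n a b x ^ (1 + δ))) Filter.atTop := by
        refine lintegral_congr_ae ?_
        filter_upwards [ae_tendsto_dyadicAvg hσ] with x hx
        exact ((ENNReal.tendsto_ofReal (hx.rpow_const (Or.inl (hσ0 x).ne'))).liminf_eq).symm
    _ ≤ Filter.liminf (fun n => ∫⁻ x in Set.Ioc a b,
          ENNReal.ofReal (dyadicAvg σ n a b x ^ (1 + δ))) Filter.atTop :=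
        lintegral_liminf_le fun n =>
          ((measurable_dyadicAvg σ n a b).pow_const (1 + δ)).ennreal_ofReal
    _ ≤ ENNReal.ofReal ((b - a) * bellman s δ (intervalAvg w a b) (intervalAvg σ a b)) :=
        Filter.liminf_le_of_frequently_le' (Filter.Frequently.of_forall fun n =>
          lintegral_dyadicAvg_rpow_le hs hδ hδ' n hab hw hσ hw0 hσ0 hlow hupp)
    _ ≤ _ := by
        refine ENNReal.ofReal_le_ofReal (mul_le_mul_of_nonneg_left ?_ (by linarith))
        exact sub_le_self _ (mul_nonneg (Real.rpow_nonneg (intervalAvg_pos hab hw hw0).le _)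
          (inv_nonneg.2 (intervalAvg_pos hab hσ hσ0).le))

/-- Jensen's inequality for the convex function `t ↦ t ^ (-r)`. -/
theorem rpow_neg_intervalAvg_le {w : ℝ → ℝ} {r a b : ℝ} (hr : 0 ≤ r) (hab : a < b)
    (hw0 : ∀ x, 0 < w x) (hw : IntegrableOn w (Set.Ioc a b))
    (hσ : IntegrableOn (fun x => w x ^ (-r)) (Set.Ioc a b)) :
    intervalAvg w a b ^ (-r) ≤ intervalAvg (fun x => w x ^ (-r)) a b := by
  have hm := intervalAvg_pos hab hw hw0
  obtain ⟨m, hmdef⟩ : ∃ m, m = intervalAvg w a b := ⟨_, rfl⟩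
  rw [← hmdef] at hm ⊢
  have hba : 0 < b - a := by linarith
  have hI : ∫ x in a..b, w x = m * (b - a) := by
    rw [hmdef, intervalAvg, div_mul_cancel₀ _ hba.ne']
  have pt : ∀ x, m ^ (-r) * (1 + r) - m ^ (-r) * r / m * w x ≤ w x ^ (-r) := fun x => by
    have ht : 0 < w x / m := div_pos (hw0 x) hm
    have h₁ : 1 - r * (w x / m - 1) ≤ (w x / m) ^ (-r) := by
      rw [Real.rpow_def_of_pos ht]
      have h₂ := Real.add_one_le_exp (Real.log (w x / m) * -r)
      have h₃ := mul_le_mul_of_nonneg_left (Real.log_le_sub_one_of_pos ht) hr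
      linarith
    have h₄ := mul_le_mul_of_nonneg_left h₁ (Real.rpow_nonneg hm.le (-r))
    rw [← Real.mul_rpow hm.le ht.le, mul_div_cancel₀ _ hm.ne'] at h₄
    refine le_trans (le_of_eq ?_) h₄
    field_simp
    ring
  have hw' := (intervalIntegrable_iff_integrableOn_Ioc_of_le hab.le).2 hw
  have hσ' := (intervalIntegrable_iff_integrableOn_Ioc_of_le hab.le).2 hσ
  have := intervalIntegral.integral_mono_on hab.le
    (intervalIntegrable_const.sub (hw'.const_mul _)) hσ' fun x _ => pt x
  rw [intervalIntegral.integral_sub intervalIntegrable_const (hw'.const_mul _),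
    intervalIntegral.integral_const, intervalIntegral.integral_const_mul, hI, smul_eq_mul] at this
  rw [intervalAvg, le_div_iff₀ hba]
  refine le_trans (le_of_eq ?_) this
  field_simp
  ring

/-- **Reverse Hölder inequality** for the dual weight of a Muckenhoupt weight. -/
theorem ApWith.lintegral_rpow_le {p B δ : ℝ} (hp : 1 < p) {w : ℝ → ℝ} (hw0 : ∀ x, 0 < w x)
    (hw : LocallyIntegrable w) (hA : ApWith p w B) (hδ : 0 ≤ δ) (hδ' : δ ≤ 1)
    (hδB : 4 * δ ≤ B ^ (-((2 + δ) / (p - 1)))) {a b : ℝ} (hab : a < b)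
    (hσ : IntegrableOn (fun x => w x ^ (-1 / (p - 1))) (Set.Ioc a b)) :
    ∫⁻ x in Set.Ioc a b, ENNReal.ofReal ((w x ^ (-1 / (p - 1))) ^ (1 + δ)) ≤
      ENNReal.ofReal ((b - a) *
        (2 * intervalAvg (fun x => w x ^ (-1 / (p - 1))) a b ^ (1 + δ))) := by
  have hq : 0 < p - 1 := by linarith
  have hs : 0 ≤ (2 + δ) / (p - 1) := by positivity
  have hσ0 : ∀ x, 0 < w x ^ (-1 / (p - 1)) := fun x => Real.rpow_pos_of_pos (hw0 x) _
  have hwI : ∀ l r, IntegrableOn w (Set.Ioc l r) := fun l r =>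
    (hw.integrableOn_isCompact isCompact_Icc).mono_set Set.Ioc_subset_Icc_self
  refine _root_.lintegral_rpow_le hs hδ hδ' hab (hwI a b) hσ hw0 hσ0 ?_ ?_
  all_goals
    intro l r hl hlr hr
    have hσ' := hσ.mono_set (Set.Ioc_subset_Ioc hl hr)
    have hx := intervalAvg_pos hlr (hwI l r) hw0
    have hy := intervalAvg_pos hlr hσ' hσ0
  · unfold bellman
    rw [rpow_neg_mul_inv_eq hq hx hy]
    have h₁ : 1 ≤ intervalAvg w l r *
        intervalAvg (fun x => w x ^ (-1 / (p - 1))) l r ^ (p - 1) := by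
      have hJ := rpow_neg_intervalAvg_le (r := 1 / (p - 1)) (by positivity) hlr hw0 (hwI l r)
        (by simpa only [neg_div] using hσ')
      simp only [← neg_div] at hJ
      have h₂ := Real.rpow_le_rpow (Real.rpow_nonneg hx.le _) hJ hq.le
      rw [← Real.rpow_mul hx.le, div_mul_cancel₀ _ hq.ne', Real.rpow_neg_one] at h₂
      have h₃ := mul_le_mul_of_nonneg_left h₂ hx.le
      rwa [mul_inv_cancel₀ hx.ne'] at h₃
    have h₄ := mul_le_mul_of_nonneg_right
      (Real.rpow_le_one_of_one_le_of_nonpos h₁ (neg_nonpos.2 hs))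
      (Real.rpow_nonneg hy.le (1 + δ))
    linarith
  · rw [rpow_neg_mul_inv_eq hq hx hy]
    refine mul_le_mul_of_nonneg_right (hδB.trans ?_) (Real.rpow_nonneg hy.le _)
    exact Real.rpow_le_rpow_of_nonpos (mul_pos hx (Real.rpow_pos_of_pos hy _)) (hA l r hlr)
      (neg_nonpos.2 hs)

theorem ApWith.self_improve {p B δ : ℝ} (hp : 1 < p) {w : ℝ → ℝ} (hw0 : ∀ x, 0 < w x)
    (hw : LocallyIntegrable w) (hA : ApWith p w B) (hB : 1 ≤ B) (hδ : 0 ≤ δ) (hδ' : δ ≤ 1)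
    (hδB : 4 * δ ≤ B ^ (-((2 + δ) / (p - 1)))) :
    ApWith (1 + (p - 1) / (1 + δ)) w (2 ^ ((p - 1) / (1 + δ)) * B) := by
  intro a b hab
  have hq : 0 < p - 1 := by linarith
  have hδ1 : 0 < 1 + δ := by linarith
  have hba : 0 < b - a := by linarith
  have hpow : (fun x => w x ^ (-1 / (1 + (p - 1) / (1 + δ) - 1))) =
      fun x => (w x ^ (-1 / (p - 1))) ^ (1 + δ) := by
    funext x
    rw [← Real.rpow_mul (hw0 x).le]
    congr 1
    rw [add_sub_cancel_left]
    field_simp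
  rw [hpow, add_sub_cancel_left]
  have hwI : IntegrableOn w (Set.Ioc a b) :=
    (hw.integrableOn_isCompact isCompact_Icc).mono_set Set.Ioc_subset_Icc_self
  have hx := intervalAvg_pos hab hwI hw0
  have hmeas : AEStronglyMeasurable (fun x => w x ^ (-1 / (p - 1)))
      (volume.restrict (Set.Ioc a b)) :=
    (hwI.aestronglyMeasurable.aemeasurable.pow_const _).aestronglyMeasurable
  have hmeas' : AEStronglyMeasurable (fun x => (w x ^ (-1 / (p - 1))) ^ (1 + δ))
      (volume.restrict (Set.Ioc a b)) :=
    (hmeas.aemeasurable.pow_const _).aestronglyMeasurable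
  have hσ0 : ∀ x, 0 < w x ^ (-1 / (p - 1)) := fun x => Real.rpow_pos_of_pos (hw0 x) _
  by_cases hσ : IntegrableOn (fun x => w x ^ (-1 / (p - 1))) (Set.Ioc a b)
  · have hy := intervalAvg_pos hab hσ hσ0
    have hH : intervalAvg (fun x => (w x ^ (-1 / (p - 1))) ^ (1 + δ)) a b ≤
        2 * intervalAvg (fun x => w x ^ (-1 / (p - 1))) a b ^ (1 + δ) := by
      rw [intervalAvg, div_le_iff₀' hba, intervalIntegral.integral_of_le hab.le,
        integral_eq_lintegral_of_nonneg_ae (Filter.Eventually.of_forall fun x =>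
          Real.rpow_nonneg (hσ0 x).le _) hmeas']
      exact ENNReal.toReal_le_of_le_ofReal (by positivity)
        (hA.lintegral_rpow_le hp hw0 hw hδ hδ' hδB hab hσ)
    have hnn : 0 ≤ intervalAvg (fun x => (w x ^ (-1 / (p - 1))) ^ (1 + δ)) a b :=
      div_nonneg (intervalIntegral.integral_nonneg hab.le fun x _ =>
        Real.rpow_nonneg (hσ0 x).le _) hba.le
    have hH' := Real.rpow_le_rpow hnn hH (z := (p - 1) / (1 + δ)) (by positivity)
    rw [Real.mul_rpow zero_le_two (by positivity), ← Real.rpow_mul hy.le,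
      mul_div_cancel₀ _ hδ1.ne'] at hH'
    calc _ ≤ _ := mul_le_mul_of_nonneg_left hH' hx.le
      _ = 2 ^ ((p - 1) / (1 + δ)) * (intervalAvg w a b *
          intervalAvg (fun x => w x ^ (-1 / (p - 1))) a b ^ (p - 1)) := by ring
      _ ≤ _ := mul_le_mul_of_nonneg_left (hA a b hab) (by positivity)
  · have hni : ¬ IntervalIntegrable (fun x => (w x ^ (-1 / (p - 1))) ^ (1 + δ)) volume a b := by
      rw [intervalIntegrable_iff_integrableOn_Ioc_of_le hab.le]
      intro h
      refine hσ (Integrable.mono' (Integrable.add (integrable_const (1 : ℝ)) h) hmeas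
        (Filter.Eventually.of_forall fun x => ?_))
      rw [Real.norm_of_nonneg (hσ0 x).le]
      simp only [Pi.add_apply]
      rcases le_total (w x ^ (-1 / (p - 1))) 1 with h₁ | h₁
      · linarith [Real.rpow_nonneg (hσ0 x).le (1 + δ)]
      · linarith [Real.self_le_rpow_of_one_le h₁ (show 1 ≤ 1 + δ by linarith)]
    rw [intervalAvg.eq_1 (fun x => (w x ^ (-1 / (p - 1))) ^ (1 + δ)),
      intervalIntegral.integral_undef hni, zero_div, Real.zero_rpow (by positivity), mul_zero]
    positivity

/-- openness of the Muckenhoupt classes: if `w ∈ A_p` then `w ∈ A_{p-ε}` for some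
`ε > 0`, with `ε` and the bound on `[w]_{A_{p-ε}}` depending only on `p` and the bound `B` on
`[w]_{A_p}` (hence uniform over families with uniformly bounded `A_p`-constant). -/
theorem Ap_open_ended (p B : ℝ) (hp : 1 < p) (hB : 0 < B) :
    ∃ ε > (0:ℝ), 1 < p - ε ∧ ∃ B' > (0:ℝ), ∀ w : ℝ → ℝ,
      (∀ x, 0 < w x) → MeasureTheory.LocallyIntegrable w →
      ApWith p w B → ApWith (p - ε) w B' := by
  have hq : 0 < p - 1 := by linarith
  set M := max B 1 with hM
  have hM1 : 1 ≤ M := le_max_right _ _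
  have hM0 : 0 < M := by linarith
  set δ := M ^ (-(3 / (p - 1))) / 4 with hδdef
  have hle1 : M ^ (-(3 / (p - 1))) ≤ 1 :=
    Real.rpow_le_one_of_one_le_of_nonpos hM1 (neg_nonpos.2 (by positivity))
  have hδ : 0 < δ := by positivity
  have hδ1 : δ ≤ 1 := by linarith
  have hδM : 4 * δ ≤ M ^ (-((2 + δ) / (p - 1))) := by
    rw [hδdef, mul_div_cancel₀ _ four_ne_zero, ← hδdef]
    exact Real.rpow_le_rpow_of_exponent_le hM1 (neg_le_neg (by gcongr; linarith))
  have he : p - ((p - 1) - (p - 1) / (1 + δ)) = 1 + (p - 1) / (1 + δ) := by ring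
  refine ⟨(p - 1) - (p - 1) / (1 + δ), sub_pos.2 (div_lt_self hq (by linarith)), ?_,
    2 ^ ((p - 1) / (1 + δ)) * M, by positivity, fun w hw0 hw hA => ?_⟩
  · rw [he]
    linarith [show 0 < (p - 1) / (1 + δ) by positivity]
  · rw [he]
    exact ApWith.self_improve hp hw0 hw (fun a b hab => (hA a b hab).trans (le_max_left _ _))
      hM1 hδ.le hδ1 hδM
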